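/- Fix b ∈ ℝ. Then lim_{ε↓0} ( 1/2 − P_down(ε) )/ε = ( L₁″(b)L₂(b) − L₂″(b)L₁(b) ) / ( 4·( L₁(b)L₂′(b) − L₂(b)L₁′(b) ) ) and lim_{ε↓0} ( 1/2 − P_up(ε) )/ε = −( L₁″(b)L₂(b) − L₂″(b)L₁(b) ) / ( 4·( L₁(b)L₂′(b) − L₂(b)L₁′(b) ) ). -/

import Mathlib

open Real MeasureTheory Filter Topology

/-- The half-line Gaussian moment `∫₀^∞ z ^ p * exp (-a z² + y z) dz` as a function of `y`. -/
noncomputable def gaussMoment (a p y : ℝ) : ℝ :=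
  ∫ z in Set.Ioi (0 : ℝ), z ^ p * Real.exp (-a * z ^ 2 + y * z)

lemma integrableOn_rpow_mul_exp_quadratic {a p : ℝ} (ha : 0 < a) (hp : -1 < p) (y : ℝ) :
    IntegrableOn (fun z : ℝ => z ^ p * Real.exp (-a * z ^ 2 + y * z)) (Set.Ioi 0) := by
  have hdom := (integrableOn_rpow_mul_exp_neg_mul_sq (half_pos ha) hp).const_mul
    (Real.exp (y ^ 2 / (2 * a)))
  refine Integrable.mono' hdom (by fun_prop) ?_
  filter_upwards [ae_restrict_mem measurableSet_Ioi] with z hz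
  have hz : 0 < z := hz
  rw [Real.norm_of_nonneg (by positivity), mul_left_comm, ← Real.exp_add]
  refine mul_le_mul_of_nonneg_left (Real.exp_le_exp.mpr ?_) (Real.rpow_nonneg hz.le p)
  have hsq : y ^ 2 / (2 * a) + -(a / 2) * z ^ 2 - (-a * z ^ 2 + y * z)
      = (a * z - y) ^ 2 / (2 * a) := by field_simp; ring
  have : 0 ≤ (a * z - y) ^ 2 / (2 * a) := by positivity
  linarith

lemma gaussMoment_pos {a p : ℝ} (ha : 0 < a) (hp : -1 < p) (y : ℝ) : 0 < gaussMoment a p y := by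
  have hpos : ∀ z ∈ Set.Ioi (0 : ℝ), 0 < z ^ p * Real.exp (-a * z ^ 2 + y * z) :=
    fun z hz => mul_pos (Real.rpow_pos_of_pos hz p) (Real.exp_pos _)
  rw [gaussMoment, setIntegral_pos_iff_support_of_nonneg_ae
    (by filter_upwards [ae_restrict_mem measurableSet_Ioi] with z hz using (hpos z hz).le)
    (integrableOn_rpow_mul_exp_quadratic ha hp y)]
  rw [Set.inter_eq_right.mpr fun z hz => Function.mem_support.mpr (hpos z hz).ne']
  simp

lemma hasDerivAt_gaussMoment {a p : ℝ} (ha : 0 < a) (hp : -1 < p) (y : ℝ) :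
    HasDerivAt (gaussMoment a p) (gaussMoment a (p + 1) y) y := by
  refine (hasDerivAt_integral_of_dominated_loc_of_deriv_le
    (F := fun y z : ℝ => z ^ p * Real.exp (-a * z ^ 2 + y * z))
    (F' := fun y z : ℝ => z ^ (p + 1) * Real.exp (-a * z ^ 2 + y * z))
    (Iic_mem_nhds (lt_add_one y)) (.of_forall fun x => by fun_prop)
    (integrableOn_rpow_mul_exp_quadratic ha hp y) (by fun_prop) ?_
    (integrableOn_rpow_mul_exp_quadratic (p := p + 1) ha (by linarith) (y + 1)) ?_).2
  · filter_upwards [ae_restrict_mem measurableSet_Ioi] with z hz x hx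
    have hz : 0 < z := hz
    have hx : x ≤ y + 1 := hx
    rw [Real.norm_of_nonneg (by positivity)]
    refine mul_le_mul_of_nonneg_left (Real.exp_le_exp.mpr ?_) (by positivity)
    gcongr
  · filter_upwards [ae_restrict_mem measurableSet_Ioi] with z hz x _
    have := ((((hasDerivAt_id x).mul_const z).const_add (-a * z ^ 2)).exp).const_mul (z ^ p)
    refine this.congr_deriv ?_
    rw [Real.rpow_add_one (ne_of_gt hz)]
    simp only [id]
    ring

/-- Second-order Taylor expansion with Peano remainder. -/
lemma tendsto_second_order_remainder {f f' : ℝ → ℝ} {f'' b : ℝ}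
    (hf : ∀ x, HasDerivAt f (f' x) x) (hf' : HasDerivAt f' f'' b) :
    Tendsto (fun ε => (f (b + ε) - f b - ε * f' b) / ε ^ 2) (𝓝[≠] 0) (𝓝 (f'' / 2)) := by
  have hnum : ∀ ε, HasDerivAt (fun ε => f (b + ε) - f b - ε * f' b) (f' (b + ε) - f' b) ε := by
    intro ε
    exact ((((hf (b + ε)).comp_const_add b ε).sub_const (f b)).sub
      ((hasDerivAt_id ε).mul_const (f' b))).congr_deriv (by rw [one_mul])
  have hden : ∀ ε : ℝ, HasDerivAt (fun ε : ℝ => ε ^ 2) (2 * ε) ε := fun ε => by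
    simpa using hasDerivAt_pow 2 ε
  refine HasDerivAt.lhopital_zero_nhdsNE (.of_forall hnum) (.of_forall hden) ?_ ?_ ?_ ?_
  · filter_upwards [self_mem_nhdsWithin] with ε hε
    exact mul_ne_zero two_ne_zero hε
  · simpa using (hnum 0).continuousAt.tendsto.mono_left nhdsWithin_le_nhds
  · simpa using (hden 0).continuousAt.tendsto.mono_left nhdsWithin_le_nhds
  · refine (hf'.tendsto_slope_zero.div_const 2).congr fun ε => ?_
    rw [smul_eq_mul]
    field_simp

/-- Midpoint expansion of `(f b * g (b - ε) - g b * f (b - ε)) / W`, where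
`W = f (b + ε) * g (b - ε) - g (b + ε) * f (b - ε)`, for a pair with nonzero Wronskian at `b`. The
case `ε < 0` covers the reflected ratio. -/
lemma tendsto_half_sub_exit_ratio {f f' g g' : ℝ → ℝ} {f'' g'' b : ℝ}
    (hf : ∀ x, HasDerivAt f (f' x) x) (hf' : HasDerivAt f' f'' b)
    (hg : ∀ x, HasDerivAt g (g' x) x) (hg' : HasDerivAt g' g'' b)
    (hne : f b * g' b - g b * f' b ≠ 0) :
    Tendsto (fun ε => (1 / 2 - (f b * g (b - ε) - g b * f (b - ε)) /
        (f (b + ε) * g (b - ε) - g (b + ε) * f (b - ε))) / ε) (𝓝[≠] 0)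
      (𝓝 (-((f'' * g b - g'' * f b) / (4 * (f b * g' b - g b * f' b))))) := by
  have hneg : Tendsto (fun ε : ℝ => -ε) (𝓝[≠] 0) (𝓝[≠] 0) := by
    refine tendsto_nhdsWithin_iff.mpr ⟨?_, ?_⟩
    · simpa using (continuous_neg.tendsto (0 : ℝ)).mono_left nhdsWithin_le_nhds
    · filter_upwards [self_mem_nhdsWithin] with ε hε
      exact neg_ne_zero.mpr hε
  have hid : Tendsto (fun ε : ℝ => ε) (𝓝[≠] 0) (𝓝 0) := nhdsWithin_le_nhds
  have hr := tendsto_second_order_remainder hf hf'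
  have hs := tendsto_second_order_remainder hg hg'
  set r := fun ε => (f (b + ε) - f b - ε * f' b) / ε ^ 2 with hr_def
  set s := fun ε => (g (b + ε) - g b - ε * g' b) / ε ^ 2 with hs_def
  have hf_exp : ∀ ε ≠ 0, f (b + ε) = f b + ε * f' b + ε ^ 2 * r ε := fun ε hε => by
    simp only [hr_def]; field_simp; ring
  have hg_exp : ∀ ε ≠ 0, g (b + ε) = g b + ε * g' b + ε ^ 2 * s ε := fun ε hε => by
    simp only [hs_def]; field_simp; ring
  have hr' : Tendsto (fun ε => r (-ε)) (𝓝[≠] 0) (𝓝 (f'' / 2)) := hr.comp hneg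
  have hs' : Tendsto (fun ε => s (-ε)) (𝓝[≠] 0) (𝓝 (g'' / 2)) := hs.comp hneg
  have hW : Tendsto (fun ε => (f (b + ε) * g (b - ε) - g (b + ε) * f (b - ε)) / ε) (𝓝[≠] 0)
      (𝓝 (-2 * (f b * g' b - g b * f' b))) := by
    have hlim : Tendsto (fun ε =>
        (f b + ε * f' b + ε ^ 2 * r ε) * (-g' b + ε * s (-ε)) + (f' b + ε * r ε) * g b
        - ((g b + ε * g' b + ε ^ 2 * s ε) * (-f' b + ε * r (-ε)) + (g' b + ε * s ε) * f b))
        (𝓝[≠] 0)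
        (𝓝 ((f b + 0 * f' b + 0 ^ 2 * (f'' / 2)) * (-g' b + 0 * (g'' / 2))
          + (f' b + 0 * (f'' / 2)) * g b
          - ((g b + 0 * g' b + 0 ^ 2 * (g'' / 2)) * (-f' b + 0 * (f'' / 2))
          + (g' b + 0 * (g'' / 2)) * f b))) := by
      refine Tendsto.sub (Tendsto.add (.mul ?_ ?_) (.mul ?_ ?_))
        (Tendsto.add (.mul ?_ ?_) (.mul ?_ ?_)) <;>
      first
        | exact tendsto_const_nhds
        | exact ((hid.mul_const _).const_add _).add ((hid.pow 2).mul (by assumption))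
        | exact (hid.mul (by assumption)).const_add _
    refine (hlim.congr' ?_).trans (le_of_eq (by ring_nf))
    filter_upwards [self_mem_nhdsWithin] with ε hε
    have hε : ε ≠ 0 := hε
    rw [sub_eq_add_neg b, hf_exp ε hε, hg_exp ε hε, hf_exp _ (neg_ne_zero.mpr hε),
      hg_exp _ (neg_ne_zero.mpr hε)]
    field_simp
    ring
  have hN : Tendsto (fun ε => (f (b + ε) * g (b - ε) - g (b + ε) * f (b - ε)
        - 2 * (f b * g (b - ε) - g b * f (b - ε))) / ε ^ 2) (𝓝[≠] 0)
      (𝓝 (f'' * g b - g'' * f b)) := by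
    have hlim := ((((hr.mul_const (g b)).sub (hs.mul_const (f b))).add
      ((hr'.mul_const (g b)).sub (hs'.mul_const (f b)))).add
      (hid.mul ((((hs'.const_mul (f' b)).sub (hr'.const_mul (g' b))).sub
        ((hr.const_mul (g' b)).sub (hs.const_mul (f' b)))).add
        (hid.mul ((hr.mul hs').sub (hs.mul hr'))))))
    refine (hlim.congr' ?_).trans (le_of_eq (by ring_nf))
    filter_upwards [self_mem_nhdsWithin] with ε hε
    have hε : ε ≠ 0 := hε
    rw [sub_eq_add_neg b, hf_exp ε hε, hg_exp ε hε, hf_exp _ (neg_ne_zero.mpr hε),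
      hg_exp _ (neg_ne_zero.mpr hε)]
    field_simp
    ring
  have hW0 : -2 * (f b * g' b - g b * f' b) ≠ 0 := mul_ne_zero (by norm_num) hne
  have hlim := hN.div (hW.const_mul 2) (mul_ne_zero two_ne_zero hW0)
  refine (hlim.congr' ?_).trans (le_of_eq ?_)
  · filter_upwards [self_mem_nhdsWithin, hW.eventually_ne hW0] with ε hε hWε
    have hε : ε ≠ 0 := hε
    have hWε := (div_ne_zero_iff.mp hWε).1
    simp only [Pi.div_apply]
    field_simp
  · congr 1
    field_simp
    ring

/-- With `W(ε) = L₁(b+ε)L₂(b−ε) − L₂(b+ε)L₁(b−ε)`,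
`P_up(ε) = (L₁(b)L₂(b−ε) − L₂(b)L₁(b−ε))/W(ε)` and
`P_down(ε) = (L₂(b)L₁(b+ε) − L₁(b)L₂(b+ε))/W(ε)`, we have
`lim_{ε↓0} (1/2 − P_down(ε))/ε = (L₁''(b)L₂(b) − L₂''(b)L₁(b)) / (4(L₁(b)L₂'(b) − L₂(b)L₁'(b)))`
and `lim_{ε↓0} (1/2 − P_up(ε))/ε` equals the negative of that quantity. -/
theorem stmt14 (κ μ σ q b : ℝ) (hκ : 0 < κ) (hσ : 0 < σ) (hq : 0 < q)
    (L₁ L₂ : ℝ → ℝ)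
    (hL₁ : ∀ x : ℝ, L₁ x = ∫ z in Set.Ioi (0 : ℝ),
      z ^ (q / κ - 1) * Real.exp (-σ ^ 2 * z ^ 2 / (4 * κ) + μ * z / κ)
        * Real.exp (-x * z))
    (hL₂ : ∀ x : ℝ, L₂ x = ∫ z in Set.Iio (0 : ℝ),
      |z| ^ (q / κ - 1) * Real.exp (-σ ^ 2 * z ^ 2 / (4 * κ) + μ * z / κ)
        * Real.exp (-x * z))
    (W Pup Pdown : ℝ → ℝ)
    (hW : ∀ ε : ℝ, W ε = L₁ (b + ε) * L₂ (b - ε) - L₂ (b + ε) * L₁ (b - ε))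
    (hPup : ∀ ε : ℝ, Pup ε = (L₁ b * L₂ (b - ε) - L₂ b * L₁ (b - ε)) / W ε)
    (hPdown : ∀ ε : ℝ, Pdown ε = (L₂ b * L₁ (b + ε) - L₁ b * L₂ (b + ε)) / W ε) :
    Tendsto (fun ε : ℝ => (1 / 2 - Pdown ε) / ε) (𝓝[>] 0)
      (𝓝 ((deriv (deriv L₁) b * L₂ b - deriv (deriv L₂) b * L₁ b)
        / (4 * (L₁ b * deriv L₂ b - L₂ b * deriv L₁ b)))) ∧
    Tendsto (fun ε : ℝ => (1 / 2 - Pup ε) / ε) (𝓝[>] 0)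
      (𝓝 (-((deriv (deriv L₁) b * L₂ b - deriv (deriv L₂) b * L₁ b)
        / (4 * (L₁ b * deriv L₂ b - L₂ b * deriv L₁ b))))) := by
  have ha : 0 < σ ^ 2 / (4 * κ) := by positivity
  have hp : -1 < q / κ - 1 := by linarith [div_pos hq hκ]
  set a := σ ^ 2 / (4 * κ) with ha_def
  set p := q / κ - 1
  have hL₁' : L₁ = fun x => gaussMoment a p (μ / κ - x) := by
    funext x
    rw [hL₁, gaussMoment]
    refine setIntegral_congr_fun measurableSet_Ioi fun z _ => ?_
    simp only [mul_assoc, ← Real.exp_add, ha_def]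
    congr 2
    ring
  have hL₂' : L₂ = fun x => gaussMoment a p (x - μ / κ) := by
    funext x
    rw [hL₂, gaussMoment, ← integral_Iic_eq_integral_Iio, ← neg_zero, ← integral_comp_neg_Iic,
      neg_zero]
    simp_rw [integral_Iic_eq_integral_Iio]
    refine setIntegral_congr_fun measurableSet_Iio fun z hz => ?_
    simp only [mul_assoc, ← Real.exp_add, ha_def, abs_of_neg (Set.mem_Iio.mp hz)]
    congr 2
    ring
  have hd₁ : ∀ r > -1, ∀ x, HasDerivAt (fun x => gaussMoment a r (μ / κ - x))
      (-gaussMoment a (r + 1) (μ / κ - x)) x := fun r hr x =>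
    (hasDerivAt_gaussMoment ha hr _).comp_const_sub (μ / κ) x
  have hd₂ : ∀ r > -1, ∀ x, HasDerivAt (fun x => gaussMoment a r (x - μ / κ))
      (gaussMoment a (r + 1) (x - μ / κ)) x := fun r hr x =>
    (hasDerivAt_gaussMoment ha hr _).comp_sub_const x (μ / κ)
  have hp' : -1 < p + 1 := by linarith
  have h₁ : ∀ x, HasDerivAt L₁ (deriv L₁ x) x := fun x => by
    rw [hL₁']; exact (hd₁ p hp x).differentiableAt.hasDerivAt
  have h₂ : ∀ x, HasDerivAt L₂ (deriv L₂ x) x := fun x => by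
    rw [hL₂']; exact (hd₂ p hp x).differentiableAt.hasDerivAt
  have hD₁ : deriv L₁ = fun x => -gaussMoment a (p + 1) (μ / κ - x) := by
    funext x; rw [hL₁']; exact (hd₁ p hp x).deriv
  have hD₂ : deriv L₂ = fun x => gaussMoment a (p + 1) (x - μ / κ) := by
    funext x; rw [hL₂']; exact (hd₂ p hp x).deriv
  have h₁' : HasDerivAt (deriv L₁) (deriv (deriv L₁) b) b := by
    rw [hD₁]; exact (hd₁ _ hp' b).neg.differentiableAt.hasDerivAt
  have h₂' : HasDerivAt (deriv L₂) (deriv (deriv L₂) b) b := by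
    rw [hD₂]; exact (hd₂ _ hp' b).differentiableAt.hasDerivAt
  have hne : L₁ b * deriv L₂ b - L₂ b * deriv L₁ b ≠ 0 := by
    rw [hD₁, hD₂, hL₁', hL₂']
    have := gaussMoment_pos ha hp (μ / κ - b)
    have := gaussMoment_pos ha hp (b - μ / κ)
    have := gaussMoment_pos ha hp' (μ / κ - b)
    have := gaussMoment_pos ha hp' (b - μ / κ)
    simp only [mul_neg, sub_neg_eq_add]
    positivity
  have hlim := tendsto_half_sub_exit_ratio h₁ h₁' h₂ h₂' hne
  have hup : Tendsto (fun ε : ℝ => (1 / 2 - Pup ε) / ε) (𝓝[>] 0)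
      (𝓝 (-((deriv (deriv L₁) b * L₂ b - deriv (deriv L₂) b * L₁ b)
        / (4 * (L₁ b * deriv L₂ b - L₂ b * deriv L₁ b))))) := by
    simp only [hPup, hW]
    exact hlim.mono_left (nhdsWithin_mono 0 fun ε hε => ne_of_gt hε)
  refine ⟨?_, hup⟩
  have hneg : Tendsto (fun ε : ℝ => -ε) (𝓝[>] 0) (𝓝[≠] 0) := by
    refine tendsto_nhdsWithin_iff.mpr ⟨?_, ?_⟩
    · simpa using (continuous_neg.tendsto (0 : ℝ)).mono_left nhdsWithin_le_nhds
    · filter_upwards [self_mem_nhdsWithin] with ε hε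
      exact neg_ne_zero.mpr (ne_of_gt hε)
  have hdown := (hlim.comp hneg).neg
  rw [neg_neg] at hdown
  refine hdown.congr fun ε => ?_
  simp only [Function.comp_apply, sub_neg_eq_add, ← sub_eq_add_neg, hPdown, hW, div_neg, neg_neg]
  rw [← neg_div_neg_eq (L₂ b * L₁ (b + ε) - L₁ b * L₂ (b + ε))]
  ring_nf
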